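/- Let p be a prime and n ≥ 1. Then W(𝔽_{p^n}), the ring of p-typical Witt vectors of the field with p^n elements, is a free module of rank n over ℤ_p. -/

import Mathlib

/-!
For a prime `p` and `n ≥ 1`, the ring of `p`-typical Witt vectors `W(𝔽_{p^n})` is a free
module of rank `n` over `ℤ_p = W(𝔽_p)` (acting via Witt vector functoriality).
-/

/-- `W(𝔽_{p^n})` is an algebra over `ℤ_p = W(𝔽_p)` via Witt vector functoriality. -/
noncomputable instance wittGaloisAlgebra (p n : ℕ) [Fact p.Prime] :
    Algebra (WittVector p (ZMod p)) (WittVector p (GaloisField p n)) :=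
  (WittVector.map (algebraMap (ZMod p) (GaloisField p n))).toAlgebra

section SpanSingleton

variable {R M N : Type*} [CommRing R] [AddCommGroup M] [Module R M] [AddCommGroup N] [Module R N]

theorem smodEq_span_singleton_pow_smul_top_iff {a : R} {k : ℕ} {x y : M} :
    x ≡ y [SMOD (Ideal.span {a} ^ k • ⊤ : Submodule R M)] ↔ ∃ z : M, a ^ k • z = x - y := by
  rw [SModEq.sub_mem, Ideal.span_singleton_pow, Submodule.ideal_span_singleton_smul,
    Submodule.mem_smul_pointwise_iff_exists]
  simp

instance IsAdicComplete.pi_span_singleton {ι : Type*} (a : R) [IsAdicComplete (Ideal.span {a}) M] :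
    IsAdicComplete (Ideal.span {a}) (ι → M) where
  haus' x hx := by
    funext i
    refine IsHausdorff.haus (I := Ideal.span {a}) inferInstance _ fun k ↦ ?_
    obtain ⟨z, hz⟩ := smodEq_span_singleton_pow_smul_top_iff.mp (hx k)
    exact smodEq_span_singleton_pow_smul_top_iff.mpr ⟨z i, congrFun hz i⟩
  prec' x hx := by
    have h (i : ι) : ∃ L : M, ∀ k, x k i ≡ L [SMOD (Ideal.span {a} ^ k • ⊤ : Submodule R M)] := by
      refine IsPrecomplete.prec' (I := Ideal.span {a}) (fun k ↦ x k i) fun hmn ↦ ?_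
      obtain ⟨z, hz⟩ := smodEq_span_singleton_pow_smul_top_iff.mp (hx hmn)
      exact smodEq_span_singleton_pow_smul_top_iff.mpr ⟨z i, congrFun hz i⟩
    choose L hL using h
    refine ⟨L, fun k ↦ smodEq_span_singleton_pow_smul_top_iff.mpr ?_⟩
    choose z hz using fun i ↦ smodEq_span_singleton_pow_smul_top_iff.mp (hL i k)
    exact ⟨z, funext hz⟩

/-- A linear map which is injective modulo `a` is injective, if its source is `a`-adically
Hausdorff and its target has no `a`-torsion. -/
theorem LinearMap.injective_of_injective_mod {a : R} [IsHausdorff (Ideal.span {a}) M]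
    (hN : IsSMulRegular N a) (f : M →ₗ[R] N)
    (hf : ∀ x y, f x = a • y → ∃ z, a • z = x) : Function.Injective f := by
  have key (k : ℕ) : ∀ x, f x = 0 → ∃ z, a ^ k • z = x := by
    induction k with
    | zero => exact fun x _ ↦ ⟨x, by simp⟩
    | succ k ih =>
      intro x hx
      obtain ⟨y, rfl⟩ := hf x 0 (by simpa using hx)
      obtain ⟨z, rfl⟩ := ih y (hN (by simpa using hx))
      exact ⟨z, by rw [pow_succ', mul_smul]⟩
  rw [injective_iff_map_eq_zero]
  refine fun x hx ↦ IsHausdorff.haus (I := Ideal.span {a}) inferInstance _ fun k ↦ ?_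
  exact smodEq_span_singleton_pow_smul_top_iff.mpr (by simpa using key k x hx)

/-- A linear map which is surjective modulo `a` is surjective, if its source is `a`-adically
complete and its target is `a`-adically Hausdorff. -/
theorem LinearMap.surjective_of_surjective_mod {a : R} [IsPrecomplete (Ideal.span {a}) M]
    [IsHausdorff (Ideal.span {a}) N] (f : M →ₗ[R] N)
    (hf : ∀ y, ∃ x z, a • z = f x - y) : Function.Surjective f := by
  refine surjective_of_mkQ_comp_surjective (I := Ideal.span {a}) fun y ↦ ?_
  obtain ⟨y, rfl⟩ := Submodule.mkQ_surjective _ y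
  obtain ⟨x, z, hz⟩ := hf y
  refine ⟨x, (Submodule.Quotient.eq _).mpr ?_⟩
  rw [← hz]
  exact Submodule.smul_mem_smul (Ideal.mem_span_singleton_self a) trivial

end SpanSingleton

theorem WittVector.exists_p_mul_eq_iff {p : ℕ} [Fact p.Prime] {k : Type*} [CommRing k] [CharP k p]
    [PerfectRing k p] {x : WittVector p k} :
    (∃ z, (p : WittVector p k) * z = x) ↔ WittVector.constantCoeff x = 0 := by
  refine Iff.trans ?_ (WittVector.mem_span_p_iff_coeff_zero_eq_zero x)
  simp [Ideal.mem_span_singleton, dvd_def, eq_comm]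

section WittGalois

variable (p n : ℕ) [Fact p.Prime]

theorem wittGalois_p_smul (x : WittVector p (GaloisField p n)) :
    (p : WittVector p (ZMod p)) • x = (p : WittVector p (GaloisField p n)) * x := by
  rw [Algebra.smul_def, map_natCast]

instance wittGalois_isHausdorff :
    IsHausdorff (Ideal.span {(p : WittVector p (ZMod p))}) (WittVector p (GaloisField p n)) := by
  rw [← IsHausdorff.map_algebraMap_iff (S := WittVector p (GaloisField p n)), Ideal.map_span,
    Set.image_singleton, map_natCast]
  infer_instance

theorem constantCoeff_linearCombination_teichmuller {ι : Type*} [Fintype ι]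
    (b : ι → GaloisField p n) (c : ι → WittVector p (ZMod p)) :
    WittVector.constantCoeff
        (Fintype.linearCombination (WittVector p (ZMod p))
          (fun i ↦ WittVector.teichmuller p (b i)) c) =
      ∑ i, WittVector.constantCoeff (c i) • b i := by
  rw [Fintype.linearCombination_apply, map_sum]
  refine Finset.sum_congr rfl fun i _ ↦ ?_
  rw [Algebra.smul_def, map_mul, Algebra.smul_def]
  congr 1

/-- The Teichmüller lifts of an `𝔽_p`-basis of `𝔽_{p^n}` give coordinates on `W(𝔽_{p^n})`. -/
theorem bijective_linearCombination_teichmuller {ι : Type*} [Fintype ι]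
    (b : Module.Basis ι (ZMod p) (GaloisField p n)) :
    Function.Bijective (Fintype.linearCombination (WittVector p (ZMod p))
      (fun i ↦ WittVector.teichmuller p (b i))) := by
  constructor
  · refine LinearMap.injective_of_injective_mod (a := (p : WittVector p (ZMod p))) ?_ _ ?_
    · intro x y hxy
      simp only [wittGalois_p_smul] at hxy
      exact mul_left_cancel₀ (WittVector.p_nonzero p _) hxy
    · intro c y hc
      have h0 : ∑ i, WittVector.constantCoeff (c i) • b i = 0 := by
        rw [← constantCoeff_linearCombination_teichmuller, hc, wittGalois_p_smul]
        exact WittVector.exists_p_mul_eq_iff.mp ⟨y, rfl⟩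
      have h := Fintype.linearIndependent_iff.mp b.linearIndependent _ h0
      choose z hz using fun i ↦ WittVector.exists_p_mul_eq_iff.mpr (h i)
      exact ⟨z, funext hz⟩
  · refine LinearMap.surjective_of_surjective_mod (a := (p : WittVector p (ZMod p))) _ fun y ↦ ?_
    choose c hc using fun i ↦
      WittVector.constantCoeff_surjective p (b.repr (WittVector.constantCoeff y) i)
    simp only [wittGalois_p_smul]
    refine ⟨c, WittVector.exists_p_mul_eq_iff.mpr ?_⟩
    rw [map_sub, constantCoeff_linearCombination_teichmuller]
    simp only [hc]
    rw [b.sum_repr, sub_self]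

end WittGalois

theorem wittVector_free_rank (p n : ℕ) [Fact p.Prime] (hn : 1 ≤ n) :
    Module.Free (WittVector p (ZMod p)) (WittVector p (GaloisField p n)) ∧
      Module.rank (WittVector p (ZMod p)) (WittVector p (GaloisField p n)) = n := by
  let b := Module.finBasisOfFinrankEq (ZMod p) (GaloisField p n)
    (GaloisField.finrank p (Nat.one_le_iff_ne_zero.mp hn))
  let e := LinearEquiv.ofBijective _ (bijective_linearCombination_teichmuller p n b)
  exact ⟨Module.Free.of_equiv e, e.rank_eq.symm.trans (rank_fin_fun n)⟩
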